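/- Let B be a commutative ring and x_1, …, x_n a regular sequence on B with (x_1, …, x_n)B ≠ B. Let B̂ denote the (x_1, …, x_n)-adic completion of B. Then the images of x_1, …, x_n form a regular sequence on B̂ and (x_1, …, x_n)B̂ ≠ B̂. -/

import Mathlib

open RingTheory.Sequence Function
open scoped Pointwise

section WeaklyRegular

variable {R M M₁ M₂ : Type*} [CommRing R] [AddCommGroup M] [Module R M]
  [AddCommGroup M₁] [Module R M₁] [AddCommGroup M₂] [Module R M₂]

/-- Weak regularity is stable under extensions. -/
theorem RingTheory.Sequence.IsWeaklyRegular.of_exact {f : M₁ →ₗ[R] M} {g : M →ₗ[R] M₂}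
    (hf : Injective f) (hfg : Exact f g) (hg : Surjective g) {rs : List R}
    (h₁ : IsWeaklyRegular M₁ rs) (h₂ : IsWeaklyRegular M₂ rs) : IsWeaklyRegular M rs := by
  induction rs generalizing M M₁ M₂ with
  | nil => exact .nil R M
  | cons r rs ih =>
    rw [isWeaklyRegular_cons_iff] at h₁ h₂ ⊢
    have hinj : Injective (QuotSMulTop.map r f) := by
      have h0 : Exact (0 : M₁ →ₗ[R] M₁) f := fun x => by
        simp [map_eq_zero_iff f hf, eq_comm]
      have := QuotSMulTop.map_first_exact_on_four_term_exact_of_isSMulRegular_last h0 hfg h₂.1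
      rw [map_zero] at this
      exact (injective_iff_map_eq_zero _).2 fun x hx => by
        obtain ⟨y, rfl⟩ := (this x).1 hx
        rfl
    exact ⟨isSMulRegular_of_range_eq_ker hf hfg.linearMap_ker_eq.symm h₁.1 h₂.1,
      ih hinj (QuotSMulTop.map_exact r hfg hg) (QuotSMulTop.map_surjective r hg) h₁.2 h₂.2⟩

/-- The first element of a weakly regular sequence stays regular modulo the remaining ones. -/
theorem RingTheory.Sequence.IsWeaklyRegular.isSMulRegular_quotient_tail {r : R} {rs : List R}
    (h : IsWeaklyRegular M (r :: rs)) :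
    IsSMulRegular (M ⧸ (Ideal.ofList rs • ⊤ : Submodule R M)) r := by
  induction rs generalizing M with
  | nil =>
    refine ((Submodule.quotEquivOfEqBot _ ?_).isSMulRegular_congr r).2
      ((isWeaklyRegular_cons_iff M r []).1 h).1
    simp
  | cons t rs ih =>
    simp only [isWeaklyRegular_cons_iff] at h
    obtain ⟨hr, ht, hrs⟩ := h
    refine ((Submodule.quotOfListConsSMulTopEquivQuotSMulTopInner M t rs).isSMulRegular_congr
      r).2 (ih ?_)
    rw [isWeaklyRegular_cons_iff]
    constructor
    · rw [hr.isSMulRegular_on_quot_iff_smul_top_inf_eq_smul, inf_comm, smul_comm]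
      exact smul_top_inf_eq_smul_of_isSMulRegular_on_quot ht
    · let e (a b : R) : QuotSMulTop a (QuotSMulTop b M) ≃ₗ[R]
          M ⧸ (b • ⊤ ⊔ a • ⊤ : Submodule R M) :=
        Submodule.quotEquivOfEq _ _
            (by rw [Submodule.map_pointwise_smul, Submodule.map_top, Submodule.range_mkQ]) ≪≫ₗ
          Submodule.quotientQuotientEquivQuotientSup (b • ⊤) (a • ⊤)
      exact ((e t r ≪≫ₗ Submodule.quotEquivOfEq _ _ (sup_comm _ _) ≪≫ₗ
        (e r t).symm).isWeaklyRegular_congr rs).1 hrs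

/-- The first element of a weakly regular sequence may be replaced by a power. -/
theorem RingTheory.Sequence.IsWeaklyRegular.pow_cons {r : R} {rs : List R}
    (h : IsWeaklyRegular M (r :: rs)) (n : ℕ) : IsWeaklyRegular M (r ^ n :: rs) := by
  rw [isWeaklyRegular_cons_iff] at h
  obtain ⟨hr, hrs⟩ := h
  refine .cons (hr.pow n) ?_
  induction n with
  | zero =>
    have : Subsingleton (QuotSMulTop (r ^ 0) M) := by
      simp [QuotSMulTop, Submodule.Quotient.subsingleton_iff]
    exact ⟨fun i hi => fun a b _ => Subsingleton.elim a b⟩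
  | succ n ih =>
    let f : QuotSMulTop r M →ₗ[R] QuotSMulTop (r ^ (n + 1)) M :=
      Submodule.mapQ _ _ (LinearMap.lsmul R M (r ^ n)) <| by
        rintro x hx
        obtain ⟨y, -, rfl⟩ := (Submodule.mem_smul_pointwise_iff_exists _ _ _).1 hx
        exact (Submodule.mem_smul_pointwise_iff_exists _ _ _).2
          ⟨y, trivial, by simp only [LinearMap.lsmul_apply, smul_smul, pow_succ]⟩
    let g : QuotSMulTop (r ^ (n + 1)) M →ₗ[R] QuotSMulTop (r ^ n) M :=
      Submodule.factor <| by
        rintro x hx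
        obtain ⟨y, -, rfl⟩ := (Submodule.mem_smul_pointwise_iff_exists _ _ _).1 hx
        exact (Submodule.mem_smul_pointwise_iff_exists _ _ _).2
          ⟨r • y, trivial, by rw [smul_smul, ← pow_succ]⟩
    refine hrs.of_exact (f := f) (g := g) ?_ ?_ ?_ ih
    · refine (injective_iff_map_eq_zero _).2 fun x => ?_
      obtain ⟨x, rfl⟩ := Submodule.Quotient.mk_surjective _ x
      intro hx
      obtain ⟨y, -, hy⟩ := (Submodule.mem_smul_pointwise_iff_exists _ _ _).1
        ((Submodule.Quotient.mk_eq_zero _).1 hx)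
      refine (Submodule.Quotient.mk_eq_zero _).2
        ((Submodule.mem_smul_pointwise_iff_exists _ _ _).2 ⟨y, trivial, hr.pow n ?_⟩)
      simpa [smul_smul, pow_succ] using hy
    · intro x
      obtain ⟨x, rfl⟩ := Submodule.Quotient.mk_surjective _ x
      constructor
      · intro hx
        obtain ⟨y, -, rfl⟩ := (Submodule.mem_smul_pointwise_iff_exists _ _ _).1
          ((Submodule.Quotient.mk_eq_zero _).1 hx)
        exact ⟨Submodule.Quotient.mk y, rfl⟩
      · rintro ⟨y, hy⟩
        obtain ⟨y, rfl⟩ := Submodule.Quotient.mk_surjective _ y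
        rw [← hy]
        exact (Submodule.Quotient.mk_eq_zero _).2
          ((Submodule.mem_smul_pointwise_iff_exists _ _ _).2 ⟨y, trivial, rfl⟩)
    · exact Submodule.factor_surjective _

theorem RingTheory.Sequence.IsWeaklyRegular.map_pow {rs : List R}
    (h : IsWeaklyRegular M rs) (n : ℕ) : IsWeaklyRegular M (rs.map (· ^ n)) := by
  induction rs generalizing M with
  | nil => exact .nil R M
  | cons r rs ih =>
    rw [isWeaklyRegular_cons_iff] at h
    exact (IsWeaklyRegular.cons h.1 (ih h.2)).pow_cons n

theorem Ideal.ofList_pow_le_ofList_map_pow (rs : List R) (n : ℕ) :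
    Ideal.ofList rs ^ (n * rs.length + 1) ≤ Ideal.ofList (rs.map (· ^ n)) := by
  induction rs with
  | nil => simp
  | cons r rs ih =>
    rw [Ideal.ofList_cons, List.map_cons, Ideal.ofList_cons, List.length_cons,
      show n * (rs.length + 1) + 1 = n + (n * rs.length + 1) by ring]
    refine Ideal.sup_pow_add_le_pow_sup_pow.trans (sup_le_sup ?_ ih)
    rw [Ideal.span_singleton_pow]

theorem Ideal.pow_smul_top_le {I J : Ideal R}
    (h : I • (⊤ : Submodule R M) ≤ J • ⊤) (n : ℕ) :
    I ^ n • (⊤ : Submodule R M) ≤ J ^ n • ⊤ := by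
  induction n with
  | zero => simp
  | succ n ih =>
    calc I ^ (n + 1) • (⊤ : Submodule R M) = I • I ^ n • ⊤ := by rw [pow_succ', mul_smul]
      _ ≤ I • J ^ n • ⊤ := smul_mono_right _ ih
      _ = J ^ n • I • ⊤ := smul_comm _ _ _
      _ ≤ J ^ n • J • ⊤ := smul_mono_right _ h
      _ = J ^ (n + 1) • ⊤ := by rw [pow_succ, mul_smul]

/-- The first element of a weakly regular sequence lowers adic orders in a controlled way. -/
theorem RingTheory.Sequence.IsWeaklyRegular.mem_pow_smul_top_of_smul_mem {I : Ideal R} {r : R}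
    {rs : List R} (h : IsWeaklyRegular M (r :: rs)) (hle : Ideal.ofList (r :: rs) ≤ I)
    (hI : I • (⊤ : Submodule R M) ≤ Ideal.ofList (r :: rs) • ⊤) (n : ℕ) {m : M}
    (hm : r • m ∈ (I ^ ((n + 1) * (rs.length + 1) + 1) • ⊤ : Submodule R M)) :
    m ∈ (I ^ n • ⊤ : Submodule R M) := by
  have hmem : ∀ t ∈ r :: rs, t ∈ I := fun t ht => hle (Ideal.subset_span ht)
  have hm' : r • m ∈ (Ideal.ofList ((r :: rs).map (· ^ (n + 1))) • ⊤ : Submodule R M) :=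
    Submodule.smul_mono_left (Ideal.ofList_pow_le_ofList_map_pow (r :: rs) (n + 1))
      (Ideal.pow_smul_top_le hI _ hm)
  rw [List.map_cons, Ideal.ofList_cons_smul] at hm'
  obtain ⟨_, hy, z, hz, hyz⟩ := Submodule.mem_sup.1 hm'
  obtain ⟨y, -, rfl⟩ := (Submodule.mem_smul_pointwise_iff_exists _ _ _).1 hy
  have hrs : IsWeaklyRegular M (r :: rs.map (· ^ (n + 1))) := by
    rw [isWeaklyRegular_cons_iff] at h
    exact .cons h.1 (h.2.map_pow _)
  have hsub : m - r ^ n • y ∈ (Ideal.ofList (rs.map (· ^ (n + 1))) • ⊤ : Submodule R M) := by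
    refine mem_of_isSMulRegular_quotient_of_smul_mem hrs.isSMulRegular_quotient_tail ?_
    rw [smul_sub, smul_smul, ← pow_succ', ← hyz]
    simpa using hz
  have hpow : Ideal.ofList (rs.map (· ^ (n + 1))) ≤ I ^ n := by
    refine Ideal.span_le.2 fun t ht => ?_
    obtain ⟨s, hs, rfl⟩ := List.mem_map.1 ht
    exact Ideal.pow_le_pow_right n.le_succ
      (Ideal.pow_mem_pow (hmem s (List.mem_cons_of_mem _ hs)) _)
  rw [← sub_add_cancel m (r ^ n • y)]
  exact add_mem (Submodule.smul_mono_left hpow hsub)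
    (Submodule.smul_mem_smul (Ideal.pow_mem_pow (hmem r List.mem_cons_self) n) trivial)

end WeaklyRegular

namespace AdicCompletion

variable {R M : Type*} [CommRing R] [AddCommGroup M] [Module R M] {I : Ideal R} {r : R} {c : ℕ → ℕ}

theorem isSMulRegular_of_smul_mem_pow (hc : ∀ n, n ≤ c n)
    (h : ∀ n (m : M), r • m ∈ (I ^ c n • ⊤ : Submodule R M) → m ∈ (I ^ n • ⊤ : Submodule R M)) :
    IsSMulRegular (AdicCompletion I M) r := by
  refine .of_right_eq_zero_of_smul fun x hx => ?_
  obtain ⟨f, rfl⟩ := mk_surjective I M x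
  ext n
  have h0 : r • f (c n) ∈ (I ^ c n • ⊤ : Submodule R M) :=
    (Submodule.Quotient.mk_eq_zero _).1 (congrArg (fun y => y.val (c n)) hx)
  exact (AdicCauchySequence.mk_eq_mk (hc n) f).symm.trans
    ((Submodule.Quotient.mk_eq_zero _).2 (h n _ h0))

theorem ker_map_mkQ_smul_top (hc : ∀ n, n ≤ c n) (hmono : Monotone c)
    (h : ∀ n (m : M), r • m ∈ (I ^ c n • ⊤ : Submodule R M) → m ∈ (I ^ n • ⊤ : Submodule R M)) :
    LinearMap.ker ((map I (r • (⊤ : Submodule R M)).mkQ).restrictScalars R) =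
      r • (⊤ : Submodule R (AdicCompletion I M)) := by
  refine le_antisymm (fun x hx => ?_) fun x hx => ?_
  · obtain ⟨f, rfl⟩ := mk_surjective I M x
    have key : ∀ n, ∃ a : M, f n - r • a ∈ (I ^ n • ⊤ : Submodule R M) := fun n => by
      have h0 : (r • (⊤ : Submodule R M)).mkQ (f n) ∈
          (I ^ n • ⊤ : Submodule R (QuotSMulTop r M)) :=
        (Submodule.Quotient.mk_eq_zero _).1 (congrArg (fun y => y.val n) hx)
      rw [← Submodule.range_mkQ, ← Submodule.map_top, ← Submodule.map_smul''] at h0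
      obtain ⟨z, hz, hzf⟩ := h0
      obtain ⟨a, -, ha⟩ := (Submodule.mem_smul_pointwise_iff_exists _ _ _).1
        ((Submodule.Quotient.eq _).1 hzf.symm)
      exact ⟨a, by rwa [ha, sub_sub_cancel]⟩
    choose a ha using key
    refine (Submodule.mem_smul_pointwise_iff_exists _ _ _).2
      ⟨mk I M (.mk I M (fun n => a (c n)) fun n => ?_), trivial, ?_⟩
    · refine SModEq.sub_mem.2 (h n _ ?_)
      have hle := hmono n.le_succ
      have h1 := ha (c n)
      have h2 := Submodule.smul_mono_left (Ideal.pow_le_pow_right hle) (ha (c (n + 1)))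
      have h3 := SModEq.sub_mem.1 (f.property hle)
      have := sub_mem (add_mem h3 h2) h1
      convert this using 1
      rw [smul_sub]
      abel_nf
    · ext n
      refine (Submodule.Quotient.eq _).2 ?_
      have h1 := Submodule.smul_mono_left (Ideal.pow_le_pow_right (hc n)) (ha (c n))
      have h3 := SModEq.sub_mem.1 (f.property (hc n))
      have := neg_mem (add_mem h3 h1)
      convert this using 1
      simp
  · obtain ⟨y, -, rfl⟩ := (Submodule.mem_smul_pointwise_iff_exists _ _ _).1 hx
    obtain ⟨f, rfl⟩ := mk_surjective I M y
    ext n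
    refine congrArg (Submodule.mkQ _) ?_
    exact (Submodule.Quotient.mk_eq_zero _).2
      ((Submodule.mem_smul_pointwise_iff_exists _ _ _).2 ⟨f n, trivial, rfl⟩)

/-- A weakly regular sequence stays weakly regular on the completion with respect to an ideal
that defines the same topology. -/
theorem isWeaklyRegular {rs : List R} (h : IsWeaklyRegular M rs) (hle : Ideal.ofList rs ≤ I)
    (hI : I • (⊤ : Submodule R M) ≤ Ideal.ofList rs • ⊤) :
    IsWeaklyRegular (AdicCompletion I M) rs := by
  induction rs generalizing M with
  | nil => exact .nil R _
  | cons r rs ih =>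
    let c : ℕ → ℕ := fun n => (n + 1) * (rs.length + 1) + 1
    have hc : ∀ n, n ≤ c n := fun n => by dsimp only [c]; nlinarith
    have hmono : Monotone c := fun a b hab => by dsimp only [c]; gcongr
    have hlow := fun n m => h.mem_pow_smul_top_of_smul_mem hle hI n (m := m)
    refine .cons (isSMulRegular_of_smul_mem_pow hc hlow) ?_
    let e : QuotSMulTop r (AdicCompletion I M) ≃ₗ[R] AdicCompletion I (QuotSMulTop r M) :=
      Submodule.quotEquivOfEq _ _ (ker_map_mkQ_smul_top hc hmono hlow).symm ≪≫ₗ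
        LinearMap.quotKerEquivOfSurjective _ (map_surjective I (Submodule.mkQ_surjective _))
    refine (e.isWeaklyRegular_congr rs).2
      (ih ((isWeaklyRegular_cons_iff M r rs).1 h).2 (le_sup_right.trans
        ((Ideal.ofList_cons r rs).symm.le.trans hle)) ?_)
    have := Submodule.map_mono (f := (r • (⊤ : Submodule R M)).mkQ) hI
    rw [Ideal.ofList_cons_smul, Submodule.map_sup, Submodule.map_smul'', Submodule.map_smul'',
      Submodule.map_top, Submodule.range_mkQ, Submodule.mkQ_map_self, bot_sup_eq] at this
    exact this

end AdicCompletion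


/-- If `x₁, …, xₙ` is a regular sequence on `B` generating a proper ideal, then the images
of the `xᵢ` in the `(x₁, …, xₙ)`-adic completion `B̂` form a regular sequence generating a
proper ideal. -/
theorem isWeaklyRegular_adicCompletion
    (B : Type*) [CommRing B] (rs : List B)
    (hreg : RingTheory.Sequence.IsWeaklyRegular B rs)
    (hproper : Ideal.ofList rs ≠ ⊤) :
    RingTheory.Sequence.IsWeaklyRegular (AdicCompletion (Ideal.ofList rs) B)
        (rs.map fun x => algebraMap B (AdicCompletion (Ideal.ofList rs) B) x) ∧
      Ideal.ofList
          (rs.map fun x => algebraMap B (AdicCompletion (Ideal.ofList rs) B) x) ≠ ⊤ := by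
  refine ⟨(isWeaklyRegular_map_algebraMap_iff _ _ _).2
    (AdicCompletion.isWeaklyRegular hreg le_rfl le_rfl), fun htop => ?_⟩
  have hker : Ideal.ofList
      (rs.map fun x => algebraMap B (AdicCompletion (Ideal.ofList rs) B) x) ≤
      RingHom.ker (AdicCompletion.evalₐ (Ideal.ofList rs) 1) := by
    refine Ideal.span_le.2 fun t ht => ?_
    obtain ⟨x, hx, rfl⟩ := List.mem_map.1 ht
    rw [SetLike.mem_coe, RingHom.mem_ker, AlgHom.commutes]
    exact Ideal.Quotient.eq_zero_iff_mem.2 (by rw [pow_one]; exact Ideal.subset_span hx)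
  have h1 : (1 : B ⧸ Ideal.ofList rs ^ 1) = 0 := by
    rw [← map_one (AdicCompletion.evalₐ (Ideal.ofList rs) 1)]
    exact hker (htop ▸ Submodule.mem_top)
  rw [← map_one (Ideal.Quotient.mk (Ideal.ofList rs ^ 1)), Ideal.Quotient.eq_zero_iff_mem, pow_one] at h1
  exact hproper ((Ideal.eq_top_iff_one _).2 h1)
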